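/- Let A₁ and A₂ be n×n complex Hermitian matrices such that A₁ + I is positive semidefinite and A₂ is positive semidefinite, and set ρ₁ = ρ(A₁ + I) and ρ₂ = ρ(A₂). Let C be the 2n×2n block matrix C = [[0, I], [-(A₁+I), -A₂]]. Then every eigenvalue μ of C satisfies |μ| ≤ ρ₂/2 + √((ρ₂/2)² + ρ₁). -/

import Mathlib

open Matrix
open scoped ComplexOrder

/-- The spectral radius of a square complex matrix: the supremum of the moduli
of its eigenvalues. -/
noncomputable def specRad {n : ℕ} (M : Matrix (Fin n) (Fin n) ℂ) : ℝ :=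
  sSup ((fun μ => ‖μ‖) '' spectrum ℂ M)

open scoped Matrix.Norms.L2Operator in
lemma norm_le_specRad_aux {n : ℕ} [Nonempty (Fin n)] (M : Matrix (Fin n) (Fin n) ℂ)
    (hM : M.IsHermitian) : ‖M‖ ≤ specRad M := by
  obtain ⟨k, hk, hk'⟩ := spectrum.exists_nnnorm_eq_spectralRadius M
  rw [IsSelfAdjoint.spectralRadius_eq_nnnorm (show IsSelfAdjoint M from hM)] at hk'
  have h1 : ‖k‖₊ = ‖M‖₊ := by exact_mod_cast hk'
  have h2 : ‖k‖ = ‖M‖ := congrArg NNReal.toReal h1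
  rw [← h2]
  refine le_csSup ?_ ⟨k, hk, rfl⟩
  exact ((spectrum.isCompact M).image continuous_norm).bddAbove

open scoped Matrix.Norms.L2Operator in
lemma norm_mulVec_le_specRad_aux {n : ℕ} [Nonempty (Fin n)] (M : Matrix (Fin n) (Fin n) ℂ)
    (hM : M.IsHermitian) (x : Fin n → ℂ) :
    ‖WithLp.toLp 2 (M *ᵥ x)‖ ≤ specRad M * ‖WithLp.toLp 2 x‖ :=
  (Matrix.l2_opNorm_mulVec M (WithLp.toLp 2 x)).trans
    (mul_le_mul_of_nonneg_right (norm_le_specRad_aux M hM) (norm_nonneg _))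

theorem spectrum_double_size_radius {n : ℕ} (A₁ A₂ : Matrix (Fin n) (Fin n) ℂ)
    (hH₁ : A₁.IsHermitian) (hH₂ : A₂.IsHermitian)
    (hpsd₁ : (A₁ + 1).PosSemidef) (hpsd₂ : A₂.PosSemidef)
    (ρ₁ ρ₂ : ℝ) (hρ₁ : ρ₁ = specRad (A₁ + 1)) (hρ₂ : ρ₂ = specRad A₂)
    (C : Matrix (Fin n ⊕ Fin n) (Fin n ⊕ Fin n) ℂ)
    (hC : C = Matrix.fromBlocks 0 1 (-(A₁ + 1)) (-A₂))
    (μ : ℂ) (hμ : μ ∈ spectrum ℂ C) :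
    ‖μ‖ ≤ ρ₂ / 2 + Real.sqrt ((ρ₂ / 2) ^ 2 + ρ₁) := by
  subst hC
  rw [← Matrix.spectrum_toLin', ← Module.End.hasEigenvalue_iff_mem_spectrum] at hμ
  obtain ⟨v, hv⟩ := hμ.exists_hasEigenvector
  have hv0 := hv.2
  have hv1 := hv.apply_eq_smul
  rw [Matrix.toLin'_apply, Matrix.fromBlocks_mulVec] at hv1
  set x : Fin n → ℂ := v ∘ Sum.inl with hx
  set y : Fin n → ℂ := v ∘ Sum.inr with hy
  have e1 : y = μ • x := by
    ext i
    have := congrFun hv1 (Sum.inl i)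
    simpa [hx, hy] using this
  have e2 : -((A₁ + 1) *ᵥ x) - A₂ *ᵥ y = μ • y := by
    ext i
    have := congrFun hv1 (Sum.inr i)
    simp only [Sum.elim_inr, Matrix.neg_mulVec] at this
    simpa [sub_eq_add_neg, hy] using this
  have x0 : x ≠ 0 := by
    intro h
    apply hv0
    rw [h, smul_zero] at e1
    ext i
    rcases i with i | i
    · exact congrFun h i
    · exact congrFun e1 i
  have hne : Nonempty (Fin n) := by
    by_contra h
    rw [not_nonempty_iff] at h
    exact x0 (Subsingleton.elim _ _)
  have b1 := norm_mulVec_le_specRad_aux (A₁ + 1) hpsd₁.1 x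
  have b2 := norm_mulVec_le_specRad_aux A₂ hH₂ x
  rw [← hρ₁] at b1
  rw [← hρ₂] at b2
  have xp : 0 < ‖WithLp.toLp 2 x‖ := by
    rw [norm_pos_iff]
    intro h
    exact x0 (congrArg WithLp.ofLp h)
  have e3 : (μ * μ) • WithLp.toLp 2 x
      = -(WithLp.toLp 2 ((A₁ + 1) *ᵥ x)) - μ • WithLp.toLp 2 (A₂ *ᵥ x) := by
    rw [e1, Matrix.mulVec_smul, smul_smul] at e2
    have := congrArg (WithLp.toLp 2) e2.symm
    simpa using this
  have e4 : ‖μ‖ * ‖μ‖ * ‖WithLp.toLp 2 x‖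
      ≤ ‖WithLp.toLp 2 ((A₁ + 1) *ᵥ x)‖ + ‖μ‖ * ‖WithLp.toLp 2 (A₂ *ᵥ x)‖ := by
    have := norm_sub_le (-(WithLp.toLp 2 ((A₁ + 1) *ᵥ x))) (μ • WithLp.toLp 2 (A₂ *ᵥ x))
    rw [← e3, norm_smul, norm_smul, norm_mul, norm_neg] at this
    exact this
  have e5 : ‖μ‖ * ‖μ‖ ≤ ρ₁ + ‖μ‖ * ρ₂ := by
    refine le_of_mul_le_mul_right ?_ xp
    have := mul_le_mul_of_nonneg_left b2 (norm_nonneg μ)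
    linarith
  have e6 : ‖μ‖ - ρ₂ / 2 ≤ Real.sqrt ((ρ₂ / 2) ^ 2 + ρ₁) := by
    apply Real.le_sqrt_of_sq_le
    nlinarith
  linarith
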